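/- If a diagonal matrix Υ' ∈ ℝ^{n×n} satisfies (I_n − Υ') ∇Ṽ(ξ) = 0 for every ξ ∈ ℝⁿ, then Υ' = I_n. Consequently, the extra terms p⟨∇Ṽ, (I_n − Υ)∇Ṽ⟩ + ⟨∇p, (I_n − Υ)∇Ṽ⟩ appearing in the transformed backward Kolmogorov equation vanish for all positive functions p and all ξ only if Υ equals the identity matrix. -/

import Mathlib

open Real Finset Matrix

/-- The gradient of a scalar function on `ℝⁿ`, whose `i`-th component is the partial
derivative in the `i`-th coordinate direction. -/
noncomputable def grad {n : ℕ} (f : (Fin n → ℝ) → ℝ) (x : Fin n → ℝ) : Fin n → ℝ :=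
  fun i => fderiv ℝ f x (Pi.single i 1)

/-- If a differentiable function has identically zero `i`-th partial derivative, it is constant
along the `i`-th axis. -/
lemma const_along_of_grad_zero {n : ℕ} (f : (Fin n → ℝ) → ℝ) (hf : Differentiable ℝ f)
    (i : Fin n) (h : ∀ x, grad f x i = 0) (t : ℝ) :
    f (Pi.single i t) = f (Pi.single i 0) := by
  have hs : ∀ t : ℝ, (Pi.single i t : Fin n → ℝ) = t • Pi.single i 1 := by
    intro t
    rw [← Pi.single_smul]
    simp
  have hd : ∀ t : ℝ, HasDerivAt (fun t : ℝ => f (t • (Pi.single i 1 : Fin n → ℝ))) 0 t := by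
    intro t
    have h1 : HasDerivAt (fun t : ℝ => t • (Pi.single i 1 : Fin n → ℝ))
        ((1 : ℝ) • (Pi.single i 1 : Fin n → ℝ)) t := (hasDerivAt_id t).smul_const _
    have h2 := (hf (t • (Pi.single i 1 : Fin n → ℝ))).hasFDerivAt.comp_hasDerivAt t h1
    rw [one_smul] at h2
    have h3 := h (t • (Pi.single i 1 : Fin n → ℝ))
    unfold grad at h3
    rw [h3] at h2
    exact h2
  rw [hs t, hs 0]
  exact is_const_of_deriv_eq_zero (fun t => (hd t).differentiableAt) (fun t => (hd t).deriv) t 0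

/-- A diagonal matrix that fixes the gradient everywhere is the identity when no partial
derivative vanishes identically. -/
lemma diag_eq_one {n : ℕ} (f : (Fin n → ℝ) → ℝ) (hne : ∀ i, ∃ x, grad f x i ≠ 0)
    (U : Matrix (Fin n) (Fin n) ℝ) (hU : U.IsDiag)
    (h : ∀ x, (1 - U).mulVec (grad f x) = 0) : U = 1 := by
  obtain ⟨d, rfl⟩ : ∃ d, U = Matrix.diagonal d := ⟨_, hU.diagonal_diag.symm⟩
  rw [← Matrix.diagonal_one]
  congr 1
  funext i
  obtain ⟨x, hx⟩ := hne i
  have h1 := congrFun (h x) i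
  rw [Matrix.sub_mulVec, Matrix.one_mulVec, Pi.sub_apply, Matrix.mulVec_diagonal,
    Pi.zero_apply] at h1
  have h2 : (1 - d i) * grad f x i = 0 := by linarith
  rcases mul_eq_zero.mp h2 with h3 | h3
  · linarith
  · exact absurd h3 hx

/-- if a diagonal matrix `Υ'` satisfies `(I − Υ') ∇Ṽ(ξ) = 0` for every `ξ`, then
`Υ' = I`. Consequently, the extra terms `p⟨∇Ṽ,(I−Υ)∇Ṽ⟩ + ⟨∇p,(I−Υ)∇Ṽ⟩` of the transformed
backward Kolmogorov equation vanish for all positive `p` and all `ξ` only if `Υ = I`. -/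
theorem extra_terms_vanish_only_if_identity
    (n : ℕ) (hn : 2 ≤ n)
    (k φ : Fin n → Fin n → ℝ) (P : Fin n → ℝ)
    (hksymm : ∀ i j, k i j = k j i)
    (hknonneg : ∀ i j, 0 ≤ k i j)
    (hknz : ∃ i j, i ≠ j ∧ k i j ≠ 0)
    (hkdiag : ∀ i, k i i = 0)
    (hφsymm : ∀ i j, φ i j = φ j i)
    (hφmem : ∀ i j, φ i j ∈ Set.Ico 0 (π / 2))
    (hφdiag : ∀ i, φ i i = 0)
    (hP : ∀ i, 0 < P i)
    (V : (Fin n → ℝ) → ℝ)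
    (hV : ∀ θ, V θ =
      (∑ i, ∑ j ∈ univ.filter (fun j => i < j), k i j * (1 - Real.cos (θ i - θ j - φ i j)))
        - ∑ i, P i * θ i)
    (σ : Fin n → ℝ) (hσ : ∀ i, 0 < σ i)
    (S : Matrix (Fin n) (Fin n) ℝ) (hS : S = Matrix.diagonal σ)
    (Υ : Matrix (Fin n) (Fin n) ℝ) (hΥ : Υ = (∏ i, σ i ^ 2) • (S⁻¹ * S⁻¹))
    (Vtil : (Fin n → ℝ) → ℝ)
    (hVtil : ∀ ξ, Vtil ξ = V (S.mulVec ξ) / ∏ i, σ i ^ 2)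
    (Υ' : Matrix (Fin n) (Fin n) ℝ) (hdiag : Υ'.IsDiag)
    (hvanish : ∀ ξ : Fin n → ℝ, (1 - Υ').mulVec (grad Vtil ξ) = 0) :
    Υ' = 1
    ∧ ((∀ p : (Fin n → ℝ) → ℝ, (∀ ξ, 0 < p ξ) →
          ∀ ξ : Fin n → ℝ,
            p ξ * (grad Vtil ξ ⬝ᵥ (1 - Υ).mulVec (grad Vtil ξ))
              + (grad p ξ ⬝ᵥ (1 - Υ).mulVec (grad Vtil ξ)) = 0) →
        Υ = 1) := by
  subst hS
  have hprod : (∏ i, σ i ^ 2) ≠ 0 := (Finset.prod_pos fun i _ => pow_pos (hσ i) 2).ne'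
  have hne : ∀ i, ∃ x, grad Vtil x i ≠ 0 := by
    intro i
    by_contra! hc
    have hdiff : Differentiable ℝ Vtil := by
      have : Vtil = fun ξ => ((∑ i, ∑ j ∈ univ.filter (fun j => i < j),
          k i j * (1 - Real.cos (σ i * ξ i - σ j * ξ j - φ i j)))
            - ∑ i, P i * (σ i * ξ i)) / ∏ i, σ i ^ 2 := by
        funext ξ
        simp only [hVtil, hV, Matrix.mulVec_diagonal]
      rw [this]
      fun_prop
    have h1 := const_along_of_grad_zero Vtil hdiff i hc (2 * π / σ i)
    rw [hVtil, hVtil, div_left_inj' hprod, hV, hV] at h1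
    simp only [Matrix.mulVec_diagonal] at h1
    have hc : ∀ a, σ a * (Pi.single i (2 * π / σ i) : Fin n → ℝ) a
        = if a = i then 2 * π else 0 := by
      intro a
      by_cases ha : a = i
      · subst ha
        have := (hσ a).ne'
        simp
        field_simp
      · simp [ha]
    have hz : ∀ a, σ a * (Pi.single i 0 : Fin n → ℝ) a = 0 := by
      intro a
      simp
    simp only [hc, hz] at h1
    have hcos : ∀ a b, Real.cos ((if a = i then 2 * π else 0) - (if b = i then 2 * π else 0)
        - φ a b) = Real.cos (0 - 0 - φ a b) := by
      intro a b
      by_cases ha : a = i <;> by_cases hb : b = i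
      · simp [ha, hb]
      · simp only [ha, hb, if_true, if_false]
        rw [show 2 * π - 0 - φ i b = (0 - 0 - φ i b) + 2 * π by ring, Real.cos_add_two_pi]
      · simp only [ha, hb, if_true, if_false]
        rw [show 0 - 2 * π - φ a i = (0 - 0 - φ a i) - 2 * π by ring, Real.cos_sub_two_pi]
      · simp [ha, hb]
    simp only [hcos] at h1
    have h2 : ∑ a, P a * (if a = i then 2 * π else 0) = P i * (2 * π) := by
      simp
    rw [h2] at h1
    simp only [mul_zero, Finset.sum_const_zero] at h1
    have := mul_pos (hP i) Real.two_pi_pos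
    linarith
  refine ⟨diag_eq_one Vtil hne Υ' hdiag hvanish, fun hp => ?_⟩
  have hΥd : Υ.IsDiag := by
    rw [hΥ, Matrix.inv_diagonal, Matrix.diagonal_mul_diagonal]
    exact (Matrix.isDiag_diagonal _).smul _
  refine diag_eq_one Vtil hne Υ hΥd fun ξ => ?_
  have h1 := hp (fun _ => 1) (fun _ => one_pos) ξ
  have hg1 : grad (fun _ : Fin n → ℝ => (1 : ℝ)) ξ = 0 := by
    funext i
    simp [grad]
  rw [hg1, zero_dotProduct, add_zero, one_mul] at h1
  funext i
  have h2 := hp (fun x => Real.exp (x i)) (fun _ => Real.exp_pos _) ξ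
  have hg2 : grad (fun x : Fin n → ℝ => Real.exp (x i)) ξ = Pi.single i (Real.exp (ξ i)) := by
    funext j
    have hf : HasFDerivAt (fun x : Fin n → ℝ => Real.exp (x i))
        (Real.exp (ξ i) • (ContinuousLinearMap.proj i : (Fin n → ℝ) →L[ℝ] ℝ)) ξ :=
      (hasFDerivAt_apply i ξ).exp
    unfold grad
    rw [hf.fderiv]
    simp [Pi.single_apply, eq_comm]
  rw [h1, hg2, mul_zero, zero_add, single_dotProduct] at h2
  exact (mul_eq_zero.mp h2).resolve_left (Real.exp_pos _).ne'
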